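/- Under the PS&W setup, suppose g̃ : (0,∞) → [0,∞) is measurable with ∫₀^∞ g̃(w) dw ≤ 1 and ∫₀^∞ w^p g̃(w) dw < ∞. Then ∫_{ℝ^p} ∫_{(0,∞)ⁿ} π(β | w, y) · π(w | β, y) dw dβ < ∞; that is, the Markov transition density k(β, β′) = ∫_{(0,∞)ⁿ} π(β′ | w, y) π(w | β, y) dw of the Polson–Scott–Windle chain satisfies the trace class condition ∫_{ℝ^p} k(β, β) dβ < ∞. -/

import Mathlib

open Matrix MeasureTheory
open scoped ENNReal

/-- The precision matrix `UᵀΩ(w)U + B⁻¹` of the conditional Gaussian in the PS&W sampler. -/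
noncomputable def pswPrec {n p : ℕ} (U : Matrix (Fin n) (Fin p) ℝ)
    (B : Matrix (Fin p) (Fin p) ℝ) (w : Fin n → ℝ) : Matrix (Fin p) (Fin p) ℝ :=
  Uᵀ * Matrix.diagonal w * U + B⁻¹

/-- The vector `μ = Uᵀ(y − ½1ₙ) + B⁻¹b` in the PS&W setup. -/
noncomputable def pswMu {n p : ℕ} (U : Matrix (Fin n) (Fin p) ℝ)
    (B : Matrix (Fin p) (Fin p) ℝ) (b : Fin p → ℝ) (y : Fin n → ℝ) : Fin p → ℝ :=
  Uᵀ *ᵥ (fun i => y i - 1/2) + B⁻¹ *ᵥ b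

/-- The `N_p(Σ(w)μ, Σ(w))` density `π(β | w, y)` of the PS&W Gibbs sampler. -/
noncomputable def pswNormalDensity {n p : ℕ} (U : Matrix (Fin n) (Fin p) ℝ)
    (B : Matrix (Fin p) (Fin p) ℝ) (b : Fin p → ℝ) (y : Fin n → ℝ)
    (β : Fin p → ℝ) (w : Fin n → ℝ) : ℝ :=
  (2 * Real.pi) ^ (-(p : ℝ) / 2) * (pswPrec U B w).det ^ ((1 : ℝ) / 2) *
    Real.exp (-(1/2) * ((β - (pswPrec U B w)⁻¹ *ᵥ pswMu U B b y) ⬝ᵥ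
      (pswPrec U B w) *ᵥ (β - (pswPrec U B w)⁻¹ *ᵥ pswMu U B b y)))

/-- The conditional density `π(w | β, y) = ∏ᵢ cosh(uᵢᵀβ/2) exp(−(1/2)(uᵢᵀβ)² wᵢ) g̃(wᵢ)`
of the latent Polya–Gamma variables in the PS&W sampler. -/
noncomputable def pswPGDensity {n p : ℕ} (U : Matrix (Fin n) (Fin p) ℝ)
    (gt : ℝ → ℝ) (w : Fin n → ℝ) (β : Fin p → ℝ) : ℝ :=
  ∏ i, (Real.cosh ((U *ᵥ β) i / 2) * Real.exp (-(1/2) * ((U *ᵥ β) i) ^ 2 * w i) * gt (w i))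

/-- The quadratic form of a positive definite real matrix dominates a positive multiple of the
squared Euclidean norm. -/
lemma Matrix.PosDef.exists_mul_dotProduct_self_le {ι : Type*} [Fintype ι] {A : Matrix ι ι ℝ}
    (hA : A.PosDef) : ∃ δ > 0, ∀ x : ι → ℝ, δ * (x ⬝ᵥ x) ≤ x ⬝ᵥ A *ᵥ x := by
  have hcompact : IsCompact {x : ι → ℝ | x ⬝ᵥ x = 1} := by
    refine Metric.isCompact_of_isClosed_isBounded (isClosed_eq (by fun_prop) (by fun_prop)) ?_
    refine (Metric.isBounded_closedBall (x := (0 : ι → ℝ)) (r := 1)).subset fun x hx => ?_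
    rw [mem_closedBall_zero_iff, pi_norm_le_iff_of_nonneg zero_le_one]
    intro i
    have hi : x i * x i ≤ 1 :=
      (Finset.single_le_sum (f := fun j => x j * x j) (fun j _ => mul_self_nonneg _)
        (Finset.mem_univ i)).trans_eq hx
    rw [Real.norm_eq_abs]
    exact abs_le_one_iff_mul_self_le_one.2 hi
  obtain ⟨δ, hδ, hle⟩ := hcompact.exists_forall_le' (f := fun x : ι → ℝ => x ⬝ᵥ A *ᵥ x) (a := 0)
    (by fun_prop) (fun x hx => by
      have hx0 : x ≠ 0 := by
        rintro rfl
        simp at hx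
      simpa using hA.dotProduct_mulVec_pos hx0)
  refine ⟨δ, hδ, fun x => ?_⟩
  by_cases hx : x = 0
  · simp [hx]
  have hpos : 0 < x ⬝ᵥ x := by simpa using Matrix.dotProduct_star_self_pos_iff.2 hx
  have hsq : √(x ⬝ᵥ x) * √(x ⬝ᵥ x) = x ⬝ᵥ x := Real.mul_self_sqrt hpos.le
  have hs : √(x ⬝ᵥ x) ≠ 0 := (Real.sqrt_pos.2 hpos).ne'
  have h := hle ((√(x ⬝ᵥ x))⁻¹ • x) (by
    simp only [Set.mem_ofPred_eq, smul_dotProduct, dotProduct_smul, smul_eq_mul]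
    nth_rw 3 [← hsq]
    field_simp)
  simp only [mulVec_smul, smul_dotProduct, dotProduct_smul, smul_eq_mul, ← mul_assoc,
    ← mul_inv, hsq] at h
  rwa [le_inv_mul_iff₀ hpos, mul_comm] at h

/-- Two-sided exponential growth does not destroy integrability of a Gaussian. -/
lemma integrable_exp_neg_mul_sq_add_mul_abs {a : ℝ} (ha : 0 < a) (c : ℝ) :
    Integrable fun x : ℝ => Real.exp (-a * x ^ 2 + c * |x|) := by
  refine ((integrable_exp_neg_mul_sq (half_pos ha)).const_mul
    (Real.exp (c ^ 2 / (2 * a)))).mono' (by fun_prop) (.of_forall fun x => ?_)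
  rw [Real.norm_eq_abs, Real.abs_exp, ← Real.exp_add, Real.exp_le_exp]
  have h : c ^ 2 / (2 * a) + -(a / 2) * x ^ 2 - (-a * x ^ 2 + c * |x|)
      = (c - a * |x|) ^ 2 / (2 * a) := by
    rw [← sq_abs x]
    field_simp
    ring
  have : 0 ≤ (c - a * |x|) ^ 2 / (2 * a) := by positivity
  linarith

/-- Integrability of `g` and of `w ^ p * g` on `(0, ∞)` gives that of `(1 + w) ^ p * g`. -/
lemma integrableOn_one_add_pow_mul {g : ℝ → ℝ} {p : ℕ} (hg : IntegrableOn g (Set.Ioi 0))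
    (hgp : IntegrableOn (fun w => w ^ p * g w) (Set.Ioi 0)) :
    IntegrableOn (fun w => (1 + w) ^ p * g w) (Set.Ioi 0) := by
  refine ((hg.norm.add hgp.norm).const_mul (2 ^ (p - 1))).mono'
    ((by fun_prop : Continuous fun w : ℝ => (1 + w) ^ p).aestronglyMeasurable.mul
      hg.aestronglyMeasurable) ?_
  refine (ae_restrict_mem measurableSet_Ioi).mono fun w (hw : 0 < w) => ?_
  have h := add_pow_le zero_le_one hw.le p
  simp only [Pi.add_apply, norm_mul, norm_pow, Real.norm_eq_abs, abs_of_pos hw,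
    abs_of_pos (add_pos one_pos hw)]
  rw [one_pow] at h
  calc (1 + w) ^ p * |g w| ≤ (2 ^ (p - 1) * (1 + w ^ p)) * |g w| := by gcongr
    _ = _ := by ring

/-- Lower bound for a quadratic form centred at `P⁻¹ μ`, by expanding the square. -/
lemma quadForm_sub_inv_mulVec_ge {ι : Type*} [Fintype ι] [DecidableEq ι] {P : Matrix ι ι ℝ}
    (hP : P.PosDef) (β μ : ι → ℝ) :
    β ⬝ᵥ P *ᵥ β - 2 * (β ⬝ᵥ μ) ≤ (β - P⁻¹ *ᵥ μ) ⬝ᵥ P *ᵥ (β - P⁻¹ *ᵥ μ) := by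
  have hPm : P *ᵥ (P⁻¹ *ᵥ μ) = μ := by
    rw [mulVec_mulVec, mul_nonsing_inv _ ((isUnit_iff_isUnit_det _).1 hP.isUnit), one_mulVec]
  have hsymm : (P⁻¹ *ᵥ μ) ⬝ᵥ P *ᵥ β = β ⬝ᵥ μ := by
    have hT : Pᵀ = P := by
      rw [← conjTranspose_eq_transpose_of_trivial]
      exact hP.isHermitian
    rw [dotProduct_mulVec, ← mulVec_transpose, hT, hPm, dotProduct_comm]
  have hnonneg : 0 ≤ (P⁻¹ *ᵥ μ) ⬝ᵥ μ := by
    have h := hP.posSemidef.dotProduct_mulVec_nonneg (P⁻¹ *ᵥ μ)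
    rwa [hPm, star_trivial] at h
  rw [mulVec_sub, sub_dotProduct, dotProduct_sub, dotProduct_sub, hPm, hsymm]
  linarith

section PolsonScottWindle

variable {n p : ℕ} (U : Matrix (Fin n) (Fin p) ℝ) {B : Matrix (Fin p) (Fin p) ℝ}

lemma pswPrec_posDef (hB : B.PosDef) {w : Fin n → ℝ} (hw : 0 ≤ w) : (pswPrec U B w).PosDef := by
  have h := (PosSemidef.diagonal hw).conjTranspose_mul_mul_same U
  rw [conjTranspose_eq_transpose_of_trivial] at h
  exact hB.inv.posSemidef_add h

lemma dotProduct_pswPrec_mulVec (w : Fin n → ℝ) (β : Fin p → ℝ) :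
    β ⬝ᵥ pswPrec U B w *ᵥ β = ∑ i, (U *ᵥ β) i ^ 2 * w i + β ⬝ᵥ B⁻¹ *ᵥ β := by
  rw [pswPrec, add_mulVec, dotProduct_add, ← mulVec_mulVec, ← mulVec_mulVec,
    dotProduct_mulVec, vecMul_transpose]
  congr 1
  refine Finset.sum_congr rfl fun i _ => ?_
  rw [mulVec_diagonal]
  ring

/-- The determinant of the precision matrix grows at most polynomially in the weights. -/
lemma exists_pswPrec_det_le (B : Matrix (Fin p) (Fin p) ℝ) :
    ∃ C, 1 ≤ C ∧ ∀ w : Fin n → ℝ, 0 ≤ w → (pswPrec U B w).det ≤ C * (∏ i, (1 + w i)) ^ p := by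
  set K : ℝ := 1 + ∑ j, ∑ k, (∑ i, |U i j * U i k| + |B⁻¹ j k|) with hK
  have hK1 : 1 ≤ K := by
    have : 0 ≤ ∑ j, ∑ k, (∑ i, |U i j * U i k| + |B⁻¹ j k|) := by positivity
    linarith
  refine ⟨p.factorial * K ^ p, ?_, fun w hw => ?_⟩
  · exact one_le_mul_of_one_le_of_one_le (by exact_mod_cast p.factorial_pos) (one_le_pow₀ hK1)
  set R := ∏ i, (1 + w i) with hR
  have hR1 : 1 ≤ R := Finset.one_le_prod fun i _ => by simpa using hw i
  have hwR : ∀ i, w i ≤ R := fun i => by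
    have h := Finset.prod_le_prod_of_subset_of_one_le (f := fun i => 1 + w i)
      (Finset.subset_univ {i}) (fun i _ => add_nonneg zero_le_one (hw i))
      fun i _ _ => le_add_of_nonneg_right (hw i)
    rw [Finset.prod_singleton] at h
    linarith
  have hentry : ∀ j k, AbsoluteValue.abs (pswPrec U B w j k) ≤ K * R := fun j k => by
    have h1 : ∑ i, |U i j * U i k| + |B⁻¹ j k| ≤ K := by
      have h2 : ∑ i, |U i j * U i k| + |B⁻¹ j k| ≤ ∑ k, (∑ i, |U i j * U i k| + |B⁻¹ j k|) :=
        Finset.single_le_sum (f := fun k => ∑ i, |U i j * U i k| + |B⁻¹ j k|)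
          (fun k _ => by positivity) (Finset.mem_univ k)
      have h3 : ∑ k, (∑ i, |U i j * U i k| + |B⁻¹ j k|) ≤
          ∑ j, ∑ k, (∑ i, |U i j * U i k| + |B⁻¹ j k|) :=
        Finset.single_le_sum (f := fun j => ∑ k, (∑ i, |U i j * U i k| + |B⁻¹ j k|))
          (fun j _ => by positivity) (Finset.mem_univ j)
      linarith
    have h4 : pswPrec U B w j k = ∑ i, U i j * U i k * w i + B⁻¹ j k := by
      rw [pswPrec, Matrix.add_apply, mul_apply]
      congr 1
      refine Finset.sum_congr rfl fun i _ => ?_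
      rw [mul_diagonal, transpose_apply]
      ring
    rw [AbsoluteValue.abs_apply, h4]
    calc |∑ i, U i j * U i k * w i + B⁻¹ j k|
        ≤ ∑ i, |U i j * U i k * w i| + |B⁻¹ j k| :=
          (abs_add_le _ _).trans (by gcongr; exact Finset.abs_sum_le_sum_abs _ _)
      _ ≤ ∑ i, |U i j * U i k| * R + |B⁻¹ j k| * R := by
          refine add_le_add (Finset.sum_le_sum fun i _ => ?_)
            (le_mul_of_one_le_right (abs_nonneg _) hR1)
          rw [abs_mul, abs_of_nonneg (hw i)]
          exact mul_le_mul_of_nonneg_left (hwR i) (abs_nonneg _)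
      _ = (∑ i, |U i j * U i k| + |B⁻¹ j k|) * R := by rw [← Finset.sum_mul, add_mul]
      _ ≤ K * R := by gcongr
  have h := det_le hentry
  rw [AbsoluteValue.abs_apply, Fintype.card_fin, nsmul_eq_mul, mul_pow, ← mul_assoc] at h
  exact (le_abs_self _).trans h

/-- The integrand of the trace is dominated by a function of `β` times a function of `w`. -/
lemma exists_psw_integrand_le (hB : B.PosDef) (b : Fin p → ℝ) (y : Fin n → ℝ) {gt : ℝ → ℝ}
    (hgt : ∀ w, 0 < w → 0 ≤ gt w) :
    ∃ δ > 0, ∃ C, 0 ≤ C ∧ ∃ c : Fin p → ℝ, ∀ (β : Fin p → ℝ) (w : Fin n → ℝ), (∀ i, 0 < w i) →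
      pswNormalDensity U B b y β w * pswPGDensity U gt w β ≤
        (C * ∏ j, Real.exp (-δ * β j ^ 2 + c j * |β j|)) * ∏ i, ((1 + w i) ^ p * gt (w i)) := by
  obtain ⟨δ, hδ, hquad⟩ := hB.inv.exists_mul_dotProduct_self_le
  obtain ⟨C, hC1, hdet⟩ := exists_pswPrec_det_le U B
  set μ := pswMu U B b y with hμ
  refine ⟨δ / 2, half_pos hδ, (2 * Real.pi) ^ (-(p : ℝ) / 2) * C, by positivity,
    fun j => |μ j| + ∑ i, |U i j| / 2, fun β w hw => ?_⟩
  have hw0 : 0 ≤ w := fun i => (hw i).le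
  have hP := pswPrec_posDef U hB hw0
  have hprod : (1 : ℝ) ≤ ∏ i, (1 + w i) := Finset.one_le_prod fun i _ => by simpa using hw0 i
  have hdet' : (pswPrec U B w).det ^ ((1 : ℝ) / 2) ≤ C * (∏ i, (1 + w i)) ^ p :=
    (Real.rpow_le_rpow hP.det_pos.le (hdet w hw0) (by norm_num)).trans <|
      Real.rpow_le_self_of_one_le
        (one_le_mul_of_one_le_of_one_le hC1 (one_le_pow₀ hprod)) (by norm_num)
  have hcosh : ∏ i, (Real.cosh ((U *ᵥ β) i / 2) *
        Real.exp (-(1/2) * ((U *ᵥ β) i) ^ 2 * w i) * gt (w i)) ≤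
      Real.exp (∑ i, |(U *ᵥ β) i| / 2) * ∏ i, gt (w i) := by
    rw [Real.exp_sum, ← Finset.prod_mul_distrib]
    refine Finset.prod_le_prod (fun i _ => ?_) fun i _ => ?_
    · have := hgt _ (hw i)
      have := (Real.cosh_pos ((U *ᵥ β) i / 2)).le
      positivity
    · refine mul_le_mul_of_nonneg_right ?_ (hgt _ (hw i))
      have h1 : Real.cosh ((U *ᵥ β) i / 2) ≤ Real.exp (|(U *ᵥ β) i| / 2) := by
        rw [← Real.cosh_abs, abs_div, abs_two, Real.cosh_eq]
        have : Real.exp (-(|(U *ᵥ β) i| / 2)) ≤ Real.exp (|(U *ᵥ β) i| / 2) :=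
          Real.exp_le_exp.2 (by linarith [abs_nonneg ((U *ᵥ β) i)])
        linarith
      have h2 : Real.exp (-(1/2) * ((U *ᵥ β) i) ^ 2 * w i) ≤ 1 := by
        rw [Real.exp_le_one_iff]
        nlinarith [mul_nonneg (sq_nonneg ((U *ᵥ β) i)) (hw0 i)]
      exact (mul_le_of_le_one_right (Real.cosh_pos _).le h2).trans h1
  have hlin : ∑ i, |(U *ᵥ β) i| / 2 + β ⬝ᵥ μ ≤ ∑ j, (|μ j| + ∑ i, |U i j| / 2) * |β j| := by
    simp only [add_mul, Finset.sum_add_distrib, Finset.sum_mul]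
    rw [add_comm, Finset.sum_comm]
    refine add_le_add (Finset.sum_le_sum fun j _ => ?_) (Finset.sum_le_sum fun i _ => ?_)
    · rw [mul_comm, ← abs_mul]
      exact le_abs_self _
    · calc |(U *ᵥ β) i| / 2 ≤ (∑ j, |U i j * β j|) / 2 :=
            div_le_div_of_nonneg_right
              (Finset.abs_sum_le_sum_abs (fun j => U i j * β j) Finset.univ) zero_le_two
        _ = ∑ j, |U i j| / 2 * |β j| := by
            rw [Finset.sum_div]
            exact Finset.sum_congr rfl fun j _ => by rw [abs_mul]; ring
  have hexp : Real.exp (-(1/2) * ((β - (pswPrec U B w)⁻¹ *ᵥ μ) ⬝ᵥ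
        (pswPrec U B w) *ᵥ (β - (pswPrec U B w)⁻¹ *ᵥ μ))) *
      Real.exp (∑ i, |(U *ᵥ β) i| / 2) ≤
      ∏ j, Real.exp (-(δ / 2) * β j ^ 2 + (|μ j| + ∑ i, |U i j| / 2) * |β j|) := by
    rw [← Real.exp_add, ← Real.exp_sum, Real.exp_le_exp, Finset.sum_add_distrib, ← Finset.mul_sum]
    have h1 := quadForm_sub_inv_mulVec_ge hP β μ
    rw [dotProduct_pswPrec_mulVec] at h1
    have h2 : 0 ≤ ∑ i, (U *ᵥ β) i ^ 2 * w i :=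
      Finset.sum_nonneg fun i _ => mul_nonneg (sq_nonneg _) (hw0 i)
    have h3 := hquad β
    have h4 : β ⬝ᵥ β = ∑ j, β j ^ 2 := Finset.sum_congr rfl fun j _ => (sq _).symm
    rw [h4] at h3
    linarith
  have hg0 : 0 ≤ ∏ i, gt (w i) := Finset.prod_nonneg fun i _ => hgt _ (hw i)
  have hdet0 := Real.rpow_nonneg hP.det_pos.le ((1 : ℝ) / 2)
  rw [pswNormalDensity, pswPGDensity, ← hμ, Finset.prod_mul_distrib (f := fun i => (1 + w i) ^ p),
    Finset.prod_pow]
  refine (mul_le_mul_of_nonneg_left hcosh (by positivity)).trans ?_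
  set E₁ := Real.exp (-(1/2) * ((β - (pswPrec U B w)⁻¹ *ᵥ μ) ⬝ᵥ
        (pswPrec U B w) *ᵥ (β - (pswPrec U B w)⁻¹ *ᵥ μ)))
  set E₂ := Real.exp (∑ i, |(U *ᵥ β) i| / 2)
  calc (2 * Real.pi) ^ (-(p : ℝ) / 2) * (pswPrec U B w).det ^ ((1 : ℝ) / 2) * E₁ *
        (E₂ * ∏ i, gt (w i))
      = (2 * Real.pi) ^ (-(p : ℝ) / 2) * ((pswPrec U B w).det ^ ((1 : ℝ) / 2) * (E₁ * E₂)) *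
          ∏ i, gt (w i) := by ring
    _ ≤ (2 * Real.pi) ^ (-(p : ℝ) / 2) * ((C * (∏ i, (1 + w i)) ^ p) *
          ∏ j, Real.exp (-(δ / 2) * β j ^ 2 + (|μ j| + ∑ i, |U i j| / 2) * |β j|)) *
          ∏ i, gt (w i) := by
        have := hdet0.trans hdet'
        gcongr
    _ = _ := by ring

end PolsonScottWindle

/-- Theorem 4 (trace class property of the PS&W Markov operator): the diagonal integral
`∫ k(β, β) dβ = ∫_{ℝ^p} ∫_{(0,∞)ⁿ} π(β | w, y) π(w | β, y) dw dβ` is finite. -/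
theorem stmt_11 {n p : ℕ} (hn : 0 < n) (hp : 0 < p)
    (U : Matrix (Fin n) (Fin p) ℝ) (B : Matrix (Fin p) (Fin p) ℝ) (hB : B.PosDef)
    (b : Fin p → ℝ) (y : Fin n → ℝ) (hy : ∀ i, y i = 0 ∨ y i = 1)
    (gt : ℝ → ℝ) (hgt_meas : Measurable gt) (hgt_nonneg : ∀ w, 0 < w → 0 ≤ gt w)
    (hgt_prob : ∫⁻ w in Set.Ioi (0 : ℝ), ENNReal.ofReal (gt w) ≤ 1)
    (hgt_mom : ∫⁻ w in Set.Ioi (0 : ℝ), ENNReal.ofReal (w ^ p * gt w) < ⊤) :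
    ∫⁻ β : Fin p → ℝ,
      (∫⁻ w : Fin n → ℝ, ENNReal.ofReal (pswNormalDensity U B b y β w * pswPGDensity U gt w β)
        ∂(Measure.pi fun _ : Fin n => volume.restrict (Set.Ioi (0 : ℝ)))) ∂volume < ⊤ := by
  obtain ⟨δ, hδ, C, hC, c, hle⟩ := exists_psw_integrand_le U hB b y hgt_nonneg
  have hgt0 : ∀ᵐ w ∂volume.restrict (Set.Ioi (0 : ℝ)), 0 ≤ gt w :=
    (ae_restrict_mem measurableSet_Ioi).mono fun w hw => hgt_nonneg w hw
  have hint : IntegrableOn gt (Set.Ioi 0) :=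
    (lintegral_ofReal_ne_top_iff_integrable hgt_meas.aestronglyMeasurable hgt0).1
      (hgt_prob.trans_lt ENNReal.one_lt_top).ne
  have hint_mom : IntegrableOn (fun w => w ^ p * gt w) (Set.Ioi 0) :=
    (lintegral_ofReal_ne_top_iff_integrable
      ((by fun_prop : Measurable fun w : ℝ => w ^ p * gt w).aestronglyMeasurable)
      ((ae_restrict_mem measurableSet_Ioi).mono fun w (hw : 0 < w) =>
        mul_nonneg (pow_nonneg hw.le p) (hgt_nonneg w hw))).1 hgt_mom.ne
  set ν : Measure (Fin n → ℝ) := Measure.pi fun _ : Fin n => volume.restrict (Set.Ioi (0 : ℝ))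
  have hpos : ∀ᵐ w ∂ν, ∀ i, 0 < w i := by
    have : ν = (Measure.pi fun _ : Fin n => (volume : Measure ℝ)).restrict
        (Set.univ.pi fun _ => Set.Ioi 0) := (Measure.restrict_pi_pi _ _).symm
    rw [this]
    exact (ae_restrict_mem (MeasurableSet.univ_pi fun _ => measurableSet_Ioi)).mono
      fun w hw i => hw i (Set.mem_univ i)
  set G : (Fin p → ℝ) → ℝ := fun β => C * ∏ j, Real.exp (-δ * β j ^ 2 + c j * |β j|)
  set H : (Fin n → ℝ) → ℝ := fun w => ∏ i, ((1 + w i) ^ p * gt (w i))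
  have hG : Integrable G :=
    (Integrable.fintype_prod fun j => integrable_exp_neg_mul_sq_add_mul_abs hδ (c j)).const_mul C
  have hG0 : ∀ β, 0 ≤ G β := fun β =>
    mul_nonneg hC (Finset.prod_nonneg fun _ _ => (Real.exp_pos _).le)
  have hH : Integrable H ν :=
    Integrable.fintype_prod fun _ => integrableOn_one_add_pow_mul hint hint_mom
  have hHfin := hH.lintegral_lt_top
  calc _ ≤ ∫⁻ β, ENNReal.ofReal (G β) * ∫⁻ w, ENNReal.ofReal (H w) ∂ν := by
        refine lintegral_mono fun β => ?_
        rw [← lintegral_const_mul' _ _ ENNReal.ofReal_ne_top]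
        refine lintegral_mono_ae (hpos.mono fun w hw => ?_)
        rw [← ENNReal.ofReal_mul (hG0 β)]
        exact ENNReal.ofReal_le_ofReal (hle β w hw)
    _ = (∫⁻ β, ENNReal.ofReal (G β)) * ∫⁻ w, ENNReal.ofReal (H w) ∂ν :=
        lintegral_mul_const' _ _ hHfin.ne
    _ < ⊤ := ENNReal.mul_lt_top hG.lintegral_lt_top hHfin
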